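/- Let U be a unification problem such that no variable occurring in t₁, …, tₙ occurs in any term of U. If U is unifiable, then there exists a most general unifier θ of U such that the domain of θ contains no variable occurring in t₁, …, tₙ and ρ(θ) is a most general unifier of ρ(U); moreover, the domain of ρ(θ) also contains no variable occurring in t₁, …, tₙ. -/

import Mathlib

inductive FOTerm (F : Type) (V : Type) : Type where
  | var : V → FOTerm F V
  | app : F → List (FOTerm F V) → FOTerm F V

namespace FOTerm

variable {F V : Type}

/-- Application of a substitution to a term. -/
def subst (θ : V → FOTerm F V) : FOTerm F V → FOTerm F V
  | .var x => θ x
  | .app f ts => .app f (ts.attach.map fun ⟨t, _⟩ => subst θ t)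

/-- Replacement `ρ`: replace every occurrence of the nullary symbol `u` by `c(tl)`. -/
def replace [DecidableEq F] (u c : F) (tl : List (FOTerm F V)) : FOTerm F V → FOTerm F V
  | .var x => .var x
  | .app f [] => if f = u then .app c tl else .app f []
  | .app f ts => .app f (ts.attach.map fun ⟨t, _⟩ => replace u c tl t)

/-- Inversion `ι`: replace every outermost subterm headed by `c` by the constant `u`. -/
def invert [DecidableEq F] (u c : F) : FOTerm F V → FOTerm F V
  | .var x => .var x
  | .app f ts => if f = c then .app u [] else .app f (ts.attach.map fun ⟨t, _⟩ => invert u c t)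

/-- The variable `x` occurs in a term. -/
inductive OccursVar (x : V) : FOTerm F V → Prop
  | var : OccursVar x (.var x)
  | app {f : F} {ts : List (FOTerm F V)} {t : FOTerm F V} :
      t ∈ ts → OccursVar x t → OccursVar x (.app f ts)

/-- The function symbol `g` occurs (as head of some subterm) in a term. -/
inductive OccursFn (g : F) : FOTerm F V → Prop
  | head {ts : List (FOTerm F V)} : OccursFn g (.app g ts)
  | arg {f : F} {ts : List (FOTerm F V)} {t : FOTerm F V} :
      t ∈ ts → OccursFn g t → OccursFn g (.app f ts)

/-- The domain of a substitution: the variables it moves. -/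
def domain (θ : V → FOTerm F V) : Set V := {x | θ x ≠ FOTerm.var x}

/-- A substitution is a map from variables to terms moving only finitely many variables. -/
def IsSubst (θ : V → FOTerm F V) : Prop := (domain θ).Finite

/-- `ρ` extended to substitutions. -/
def replaceSubst [DecidableEq F] (u c : F) (tl : List (FOTerm F V))
    (θ : V → FOTerm F V) : V → FOTerm F V := fun x => replace u c tl (θ x)

/-- `ι` extended to substitutions. -/
def invertSubst [DecidableEq F] (u c : F) (θ : V → FOTerm F V) : V → FOTerm F V :=
  fun x => invert u c (θ x)

/-- Apply a term transformation to both components of every pair of a unification problem. -/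
def mapProb (g : FOTerm F V → FOTerm F V) (U : Set (FOTerm F V × FOTerm F V)) :
    Set (FOTerm F V × FOTerm F V) := (fun p => (g p.1, g p.2)) '' U

/-- `θ` unifies the unification problem `U`. -/
def Unifies (θ : V → FOTerm F V) (U : Set (FOTerm F V × FOTerm F V)) : Prop :=
  ∀ p ∈ U, subst θ p.1 = subst θ p.2

/-- `U` is unifiable. -/
def Unifiable (U : Set (FOTerm F V × FOTerm F V)) : Prop :=
  ∃ θ, IsSubst θ ∧ Unifies θ U

end FOTerm

/-- `θ` is a most general unifier of `U`: it is a substitution unifying `U`, and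
every unifier `θ'` of `U` factors through it, i.e. there is a substitution `θ''`
with `θ'(s) = θ''(θ(s))` for every term `s`. -/
def FOTerm.IsMGU {F V : Type} (θ : V → FOTerm F V)
    (U : Set (FOTerm F V × FOTerm F V)) : Prop :=
  FOTerm.IsSubst θ ∧ FOTerm.Unifies θ U ∧
    ∀ θ' : V → FOTerm F V, FOTerm.IsSubst θ' → FOTerm.Unifies θ' U →
      ∃ θ'' : V → FOTerm F V, FOTerm.IsSubst θ'' ∧
        ∀ s : FOTerm F V,
          FOTerm.subst θ' s = FOTerm.subst θ'' (FOTerm.subst θ s)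

namespace FOTerm

variable {F V : Type}

theorem term_induction {P : FOTerm F V → Prop} (hvar : ∀ x, P (.var x))
    (happ : ∀ f ts, (∀ t ∈ ts, P t) → P (.app f ts)) : ∀ t, P t
  | .var x => hvar x
  | .app f ts => happ f ts fun t _ => term_induction hvar happ t

@[simp]
theorem subst_var (θ : V → FOTerm F V) (x : V) : subst θ (.var x) = θ x := by
  simp [subst]

@[simp]
theorem subst_app (θ : V → FOTerm F V) (f : F) (ts : List (FOTerm F V)) :
    subst θ (.app f ts) = .app f (ts.map (subst θ)) := by
  simp [subst]

@[simp]
theorem replace_var [DecidableEq F] (u c : F) (tl : List (FOTerm F V)) (x : V) :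
    replace u c tl (.var x) = .var x := by
  simp [replace]

theorem replace_app_nil [DecidableEq F] (u c : F) (tl : List (FOTerm F V)) (f : F) :
    replace u c tl (.app f []) = if f = u then .app c tl else .app f [] := by
  simp [replace]

theorem replace_app_of_ne_nil [DecidableEq F] (u c : F) (tl : List (FOTerm F V)) (f : F)
    {ts : List (FOTerm F V)} (hts : ts ≠ []) :
    replace u c tl (.app f ts) = .app f (ts.map (replace u c tl)) := by
  cases ts with
  | nil => exact absurd rfl hts
  | cons t ts => simp [replace]

theorem subst_congr {θ θ' : V → FOTerm F V} {s : FOTerm F V}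
    (h : ∀ x, OccursVar x s → θ x = θ' x) : subst θ s = subst θ' s := by
  induction s using term_induction with
  | hvar x => simpa using h x .var
  | happ f ts ih =>
    simp only [subst_app, app.injEq, true_and]
    exact List.map_congr_left fun t ht => ih t ht fun x hx => h x (.app ht hx)

theorem subst_eq_self {θ : V → FOTerm F V} {s : FOTerm F V}
    (h : ∀ x, OccursVar x s → θ x = .var x) : subst θ s = s := by
  induction s using term_induction with
  | hvar x => simpa using h x .var
  | happ f ts ih =>
    simp only [subst_app, app.injEq, true_and]
    exact (List.map_congr_left fun t ht => ih t ht fun x hx => h x (.app ht hx)).trans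
      (List.map_id' ts)

theorem exists_occursVar_of_occursVar_subst {θ : V → FOTerm F V} {s : FOTerm F V} {y : V}
    (h : OccursVar y (subst θ s)) : ∃ x, OccursVar x s ∧ OccursVar y (θ x) := by
  induction s using term_induction with
  | hvar x => exact ⟨x, .var, by simpa using h⟩
  | happ f ts ih =>
    rw [subst_app] at h
    cases h with
    | app ht hy =>
      obtain ⟨t, hmem, rfl⟩ := List.mem_map.1 ht
      obtain ⟨x, hx, hxy⟩ := ih t hmem hy
      exact ⟨x, .app hmem hx, hxy⟩

/-- A map on terms that commutes with every application to a nonempty list of arguments;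
constants may be sent anywhere. -/
def CommutesWithApp (h : FOTerm F V → FOTerm F V) : Prop :=
  ∀ f ts, ts ≠ [] → h (.app f ts) = .app f (ts.map h)

theorem commutesWithApp_subst (θ : V → FOTerm F V) : CommutesWithApp (subst θ) :=
  fun f ts _ => subst_app θ f ts

theorem commutesWithApp_replace [DecidableEq F] (u c : F) (tl : List (FOTerm F V)) :
    CommutesWithApp (replace u c tl) :=
  fun f _ hts => replace_app_of_ne_nil u c tl f hts

theorem CommutesWithApp.comp {g h : FOTerm F V → FOTerm F V} (hg : CommutesWithApp g)
    (hh : CommutesWithApp h) : CommutesWithApp (g ∘ h) := by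
  intro f ts hts
  simp [hh f ts hts, hg f (ts.map h) (by simpa using hts)]

theorem CommutesWithApp.subst_eq {h : FOTerm F V → FOTerm F V} (hh : CommutesWithApp h)
    {θ : V → FOTerm F V} (hθ : ∀ x, h (θ x) = h (.var x)) (s : FOTerm F V) :
    h (subst θ s) = h s := by
  induction s using term_induction with
  | hvar x => simpa using hθ x
  | happ f ts ih =>
    by_cases hts : ts = []
    · simp [hts]
    · rw [subst_app, hh f ts hts, hh f _ (by simpa using hts), List.map_map]
      exact congrArg _ (List.map_congr_left ih)

theorem subst_subst (θ δ : V → FOTerm F V) (s : FOTerm F V) :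
    subst θ (subst δ s) = subst (fun x => subst θ (δ x)) s := by
  induction s using term_induction with
  | hvar x => simp
  | happ f ts ih => simpa using ih

theorem replace_subst [DecidableEq F] (u c : F) {tl : List (FOTerm F V)} {θ : V → FOTerm F V}
    (hθ : ∀ x ∈ domain θ, ∀ t ∈ tl, ¬ OccursVar x t) (s : FOTerm F V) :
    replace u c tl (subst θ s) = subst (replaceSubst u c tl θ) (replace u c tl s) := by
  induction s using term_induction with
  | hvar x => simp [replaceSubst]
  | happ f ts ih =>
    by_cases hts : ts = []
    · subst hts
      by_cases hf : f = u
      · rw [subst_app, List.map_nil, replace_app_nil, if_pos hf, subst_eq_self]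
        intro x hx
        cases hx with
        | app ht hx =>
          have : θ x = .var x := by
            by_contra hne
            exact hθ x hne _ ht hx
          simp [replaceSubst, this]
      · simp [replace_app_nil, hf]
    · rw [subst_app, replace_app_of_ne_nil u c tl f hts,
        replace_app_of_ne_nil u c tl f (by simpa using hts), subst_app, List.map_map,
        List.map_map]
      exact congrArg _ (List.map_congr_left ih)

theorem domain_replaceSubst_subset [DecidableEq F] (u c : F) (tl : List (FOTerm F V))
    (θ : V → FOTerm F V) : domain (replaceSubst u c tl θ) ⊆ domain θ := by
  intro x hx hθ
  exact hx (by simp [replaceSubst, hθ])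

/-- The number of symbols and variables of a term. -/
def size : FOTerm F V → ℕ
  | .var _ => 1
  | .app _ ts => (ts.attach.map fun ⟨t, _⟩ => size t).sum + 1

@[simp]
theorem size_app (f : F) (ts : List (FOTerm F V)) :
    size (.app f ts) = (ts.map size).sum + 1 := by
  simp [size]

theorem size_pos (t : FOTerm F V) : 0 < size t := by
  cases t <;> simp [size]

theorem size_le_size_subst {σ : V → FOTerm F V} {x : V} {t : FOTerm F V} (h : OccursVar x t) :
    size (σ x) ≤ size (subst σ t) := by
  induction h with
  | var => simp
  | @app f ts t ht _ ih =>
    have := List.single_le_sum (l := ts.map fun t => size (subst σ t)) (by simp) _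
      (List.mem_map_of_mem ht)
    simp only [subst_app, size_app, List.map_map, Function.comp_def]
    omega

theorem not_occursVar_app_of_eq {σ : V → FOTerm F V} {x : V} {f : F} {ts : List (FOTerm F V)}
    (h : σ x = subst σ (.app f ts)) : ¬ OccursVar x (.app f ts) := by
  intro hx
  cases hx with
  | @app _ _ t ht hx =>
    have h₁ := size_le_size_subst (σ := σ) hx
    have h₂ := List.single_le_sum (l := ts.map fun t => size (subst σ t)) (by simp) _
      (List.mem_map_of_mem ht)
    have h₃ := congrArg size h
    simp only [subst_app, size_app, List.map_map, Function.comp_def] at h₃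
    omega

/-- `θ` solves `E` moving only variables in `A`, and every map commuting with applications that
identifies the two sides of each pair of `E` is invariant under `θ`. -/
structure IsPrincipalSolution (A : Set V) (E : Set (FOTerm F V × FOTerm F V))
    (θ : V → FOTerm F V) : Prop where
  isSubst : IsSubst θ
  domain_subset : domain θ ⊆ A
  unifies : Unifies θ E
  principal : ∀ h : FOTerm F V → FOTerm F V, CommutesWithApp h → (∀ p ∈ E, h p.1 = h p.2) →
    ∀ x, h (θ x) = h (.var x)

/-- All variables of `E` belong to `A`. -/
def VarsIn (A : Set V) (E : Set (FOTerm F V × FOTerm F V)) : Prop :=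
  ∀ p ∈ E, ∀ x, OccursVar x p.1 ∨ OccursVar x p.2 → x ∈ A

theorem isPrincipalSolution_empty (A : Set V) :
    IsPrincipalSolution A (∅ : Set (FOTerm F V × FOTerm F V)) .var where
  isSubst := by simp [IsSubst, domain]
  domain_subset := by simp [domain]
  unifies := by simp [Unifies]
  principal := by simp

open Classical in
/-- The substitution replacing the single variable `x` by `t`. -/
noncomputable def single (x : V) (t : FOTerm F V) : V → FOTerm F V :=
  Function.update .var x t

theorem single_self (x : V) (t : FOTerm F V) : single x t x = t := by
  simp [single]

theorem single_of_ne {x y : V} (t : FOTerm F V) (h : y ≠ x) : single x t y = .var y := by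
  simp [single, h]

theorem apply_single {h : FOTerm F V → FOTerm F V} {x : V} {t : FOTerm F V}
    (hxt : h (.var x) = h t) (y : V) : h (single x t y) = h (.var y) := by
  by_cases hy : y = x
  · rw [hy, single_self, hxt]
  · rw [single_of_ne t hy]

theorem occursVar_subst_single {x y : V} {s t : FOTerm F V}
    (h : OccursVar y (subst (single x t) s)) : OccursVar y s ∨ OccursVar y t := by
  obtain ⟨z, hz, hy⟩ := exists_occursVar_of_occursVar_subst h
  by_cases hzx : z = x
  · rw [hzx, single_self] at hy
    exact .inr hy
  · rw [single_of_ne t hzx] at hy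
    cases hy
    exact .inl hz

theorem VarsIn.mapProb_single {A : Set V} {E : Set (FOTerm F V × FOTerm F V)} {x : V}
    {t : FOTerm F V} (hA : VarsIn A (insert (.var x, t) E)) :
    VarsIn A (mapProb (subst (single x t)) E) := by
  rintro _ ⟨p, hp, rfl⟩ y hy
  have hE := hA p (Set.mem_insert_of_mem _ hp) y
  have ht := hA _ (Set.mem_insert _ _) y
  rcases hy with hy | hy <;> rcases occursVar_subst_single hy with hy | hy <;> tauto

theorem IsPrincipalSolution.eliminate {A : Set V} {E : Set (FOTerm F V × FOTerm F V)} {x : V}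
    {t : FOTerm F V} {θ : V → FOTerm F V} (hxA : x ∈ A) (hxt : ¬ OccursVar x t)
    (hθ : IsPrincipalSolution A (mapProb (subst (single x t)) E) θ) :
    IsPrincipalSolution A (insert (.var x, t) E) fun y => subst θ (single x t y) := by
  have hdom : domain (fun y => subst θ (single x t y)) ⊆ insert x (domain θ) := by
    intro y hy
    by_cases hyx : y = x
    · exact .inl hyx
    · right
      simpa [domain, single_of_ne t hyx] using hy
  refine ⟨(hθ.isSubst.insert x).subset hdom,
    hdom.trans (Set.insert_subset hxA hθ.domain_subset), ?_, ?_⟩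
  · rintro p (rfl | hp)
    · simp only [subst_var, single_self]
      refine subst_congr fun y hy => ?_
      have hyx : y ≠ x := by
        rintro rfl
        exact hxt hy
      rw [single_of_ne t hyx, subst_var]
    · simp only [← subst_subst]
      exact hθ.unifies _ ⟨p, hp, rfl⟩
  · intro h hh hE y
    have hsingle := apply_single (hE _ (Set.mem_insert _ _))
    rw [hh.subst_eq, hsingle]
    refine hθ.principal h hh ?_
    rintro _ ⟨p, hp, rfl⟩
    simp only [hh.subst_eq hsingle]
    exact hE p (Set.mem_insert_of_mem _ hp)

theorem IsPrincipalSolution.of_equiv {A : Set V} {E E' : Set (FOTerm F V × FOTerm F V)}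
    {θ : V → FOTerm F V} (hθ : IsPrincipalSolution A E' θ)
    (hE : Unifies θ E' → Unifies θ E)
    (hE' : ∀ h : FOTerm F V → FOTerm F V, CommutesWithApp h → (∀ p ∈ E, h p.1 = h p.2) →
      ∀ p ∈ E', h p.1 = h p.2) : IsPrincipalSolution A E θ :=
  ⟨hθ.isSubst, hθ.domain_subset, hE hθ.unifies,
    fun h hh hp => hθ.principal h hh (hE' h hh hp)⟩

theorem map_eq_map_iff_forall_mem_zip {α β : Type*} (h : α → β) {l l' : List α}
    (hl : l.length = l'.length) :
    l.map h = l'.map h ↔ ∀ p ∈ l.zip l', h p.1 = h p.2 := by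
  induction l generalizing l' with
  | nil => cases l' <;> simp_all
  | cons a l ih =>
    cases l' with
    | nil => simp at hl
    | cons b l' => simp [ih (by simpa using hl)]

/-- The measure decreasing along the unification algorithm, relative to a known unifier `σ`. -/
def weight (σ : V → FOTerm F V) (E : List (FOTerm F V × FOTerm F V)) : ℕ :=
  (E.map fun p => size (subst σ p.1)).sum

theorem exists_isPrincipalSolution_list (A : Set V) (σ : V → FOTerm F V) (n : ℕ) :
    ∀ E : List (FOTerm F V × FOTerm F V), weight σ E < n → VarsIn A {p | p ∈ E} →
      Unifies σ {p | p ∈ E} → ∃ θ, IsPrincipalSolution A {p | p ∈ E} θ := by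
  induction n with
  | zero => simp
  | succ n ih =>
    rintro (_ | ⟨⟨s, t⟩, E⟩) hn hA hσ
    · exact ⟨.var, by simpa using isPrincipalSolution_empty A⟩
    have hcons (p : FOTerm F V × FOTerm F V) :
        {q | q ∈ p :: E} = insert p {q | q ∈ E} := by ext; simp
    have hst : subst σ s = subst σ t := hσ (s, t) (by simp)
    have hw : weight σ E < n := by
      have := size_pos (subst σ s)
      simp only [weight, List.map_cons, List.sum_cons] at hn ⊢
      omega
    rw [hcons] at hA hσ ⊢
    have eliminate (x : V) (t : FOTerm F V) (hxt : σ x = subst σ t) (hocc : ¬ OccursVar x t)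
        (hA : VarsIn A (insert (.var x, t) {q | q ∈ E})) :
        ∃ θ, IsPrincipalSolution A (insert (.var x, t) {q | q ∈ E}) θ := by
      have hsingle : ∀ s, subst σ (subst (single x t) s) = subst σ s :=
        (commutesWithApp_subst σ).subst_eq (apply_single (by simpa using hxt))
      have hmap : {q | q ∈ E.map fun p => (subst (single x t) p.1, subst (single x t) p.2)} =
          mapProb (subst (single x t)) {q | q ∈ E} := by
        ext; simp [mapProb]
      obtain ⟨θ, hθ⟩ := ih
        (E.map fun p => (subst (single x t) p.1, subst (single x t) p.2))
        (by simpa [weight, Function.comp_def, hsingle] using hw)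
        (by rw [hmap]; exact hA.mapProb_single)
        (by
          rw [hmap]
          rintro _ ⟨p, hp, rfl⟩
          simpa only [hsingle] using hσ p (Set.mem_insert_of_mem _ hp))
      rw [hmap] at hθ
      exact ⟨_, hθ.eliminate (hA _ (Set.mem_insert _ _) x (.inl .var)) hocc⟩
    rcases s with x | ⟨f, ss⟩ <;> rcases t with y | ⟨g, ts⟩
    · by_cases hxy : x = y
      · subst hxy
        obtain ⟨θ, hθ⟩ := ih E hw (fun p hp => hA p (.inr hp)) (fun p hp => hσ p (.inr hp))
        refine ⟨θ, hθ.of_equiv ?_ fun h _ hE p hp => hE p (.inr hp)⟩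
        rintro hE p (rfl | hp)
        · rfl
        · exact hE p hp
      · refine eliminate x (.var y) (by simpa using hst) ?_ hA
        rintro ⟨⟩
        exact hxy rfl
    · exact eliminate x _ (by simpa using hst) (not_occursVar_app_of_eq (by simpa using hst)) hA
    · obtain ⟨θ, hθ⟩ := eliminate y (.app f ss) (by simpa using hst.symm)
        (not_occursVar_app_of_eq (by simpa using hst.symm)) (by
          rintro p (rfl | hp) z hz
          · exact hA _ (Set.mem_insert _ _) z hz.symm
          · exact hA p (.inr hp) z hz)
      refine ⟨θ, hθ.of_equiv ?_ ?_⟩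
      · rintro hE p (rfl | hp)
        · exact (hE _ (Set.mem_insert _ _)).symm
        · exact hE p (.inr hp)
      · rintro h - hE p (rfl | hp)
        · exact (hE _ (Set.mem_insert _ _)).symm
        · exact hE p (.inr hp)
    · simp only [subst_app, app.injEq] at hst
      obtain ⟨rfl, hst⟩ := hst
      have hlen : ss.length = ts.length := by simpa using congrArg List.length hst
      obtain ⟨θ, hθ⟩ := ih (ss.zip ts ++ E)
        (by
          have : (ss.zip ts).map (fun p => size (subst σ p.1)) =
              ss.map fun s => size (subst σ s) := by
            rw [← List.map_fst_zip hlen.le, List.map_map, List.map_fst_zip hlen.le]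
            rfl
          simp only [weight, List.map_cons, List.sum_cons, subst_app, size_app, List.map_map,
            Function.comp_def, List.map_append, List.sum_append, this] at hn ⊢
          omega)
        (by
          intro p hp z hz
          rcases List.mem_append.1 hp with hp | hp
          · have := List.of_mem_zip (a := p.1) (b := p.2) hp
            exact hA _ (Set.mem_insert _ _) z (hz.imp (.app this.1) (.app this.2))
          · exact hA p (.inr hp) z hz)
        (by
          intro p hp
          rcases List.mem_append.1 hp with hp | hp
          · exact (map_eq_map_iff_forall_mem_zip _ hlen).1 hst p hp
          · exact hσ p (.inr hp))
      refine ⟨θ, hθ.of_equiv ?_ ?_⟩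
      · rintro hE p (rfl | hp)
        · simp only [subst_app, app.injEq, true_and]
          exact (map_eq_map_iff_forall_mem_zip _ hlen).2 fun p hp =>
            hE p (List.mem_append_left _ hp)
        · exact hE p (List.mem_append_right _ hp)
      · intro h hh hE p hp
        rcases List.mem_append.1 hp with hp | hp
        · have hmem := List.of_mem_zip (a := p.1) (b := p.2) hp
          have happ := hE _ (Set.mem_insert _ _)
          rw [hh f ss (List.ne_nil_of_mem hmem.1), hh f ts (List.ne_nil_of_mem hmem.2)] at happ
          exact (map_eq_map_iff_forall_mem_zip _ hlen).1 (app.inj happ).2 p hp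
        · exact hE p (.inr hp)

theorem exists_isPrincipalSolution {A : Set V} {U : Set (FOTerm F V × FOTerm F V)}
    (hU : U.Finite) (hA : VarsIn A U) (hunif : Unifiable U) :
    ∃ θ, IsPrincipalSolution A U θ := by
  obtain ⟨σ, -, hσ⟩ := hunif
  have hlist : {p | p ∈ hU.toFinset.toList} = U := by ext; simp
  have := exists_isPrincipalSolution_list A σ _ hU.toFinset.toList (Nat.lt_succ_self _)
  rw [hlist] at this
  exact this hA hσ

theorem IsPrincipalSolution.isMGU {A : Set V} {U : Set (FOTerm F V × FOTerm F V)}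
    {θ : V → FOTerm F V} (hθ : IsPrincipalSolution A U θ) : IsMGU θ U :=
  ⟨hθ.isSubst, hθ.unifies, fun θ' hθ' hU => ⟨θ', hθ', fun s =>
    ((commutesWithApp_subst θ').subst_eq
      (hθ.principal _ (commutesWithApp_subst θ') hU) s).symm⟩⟩

theorem IsPrincipalSolution.isMGU_replace [DecidableEq F] (u c : F) {tl : List (FOTerm F V)}
    {U : Set (FOTerm F V × FOTerm F V)} {θ : V → FOTerm F V}
    (hθ : IsPrincipalSolution {x | ∀ t ∈ tl, ¬ OccursVar x t} U θ) :
    IsMGU (replaceSubst u c tl θ) (mapProb (replace u c tl) U) := by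
  refine ⟨hθ.isSubst.subset (domain_replaceSubst_subset u c tl θ), ?_, fun θ' hθ' hU =>
    ⟨θ', hθ', fun s => ((commutesWithApp_subst θ').subst_eq (fun x => ?_) s).symm⟩⟩
  · rintro _ ⟨p, hp, rfl⟩
    simp only [← replace_subst u c hθ.domain_subset, hθ.unifies p hp]
  · simpa [replaceSubst] using hθ.principal (subst θ' ∘ replace u c tl)
      ((commutesWithApp_subst θ').comp (commutesWithApp_replace u c tl))
      (fun p hp => hU _ ⟨p, hp, rfl⟩) x

end FOTerm

/-- Let `U` be a unification problem such that no variable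
occurring in `t₁, …, tₙ` (the list `tl`) occurs in any term of `U`.  If `U` is
unifiable, then there exists an mgu `θ` of `U` whose domain contains no variable
occurring in `t₁, …, tₙ` and such that `ρ(θ)` is an mgu of `ρ(U)`; moreover, the
domain of `ρ(θ)` also contains no variable occurring in `t₁, …, tₙ`. -/
theorem exists_mgu_replace {F V : Type} [DecidableEq F]
    (u c : F) (tl : List (FOTerm F V))
    (U : Set (FOTerm F V × FOTerm F V)) (hU : U.Finite)
    (hvars : ∀ x : V, (∃ t ∈ tl, FOTerm.OccursVar x t) →
      ∀ p ∈ U, ¬ FOTerm.OccursVar x p.1 ∧ ¬ FOTerm.OccursVar x p.2)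
    (hunif : FOTerm.Unifiable U) :
    ∃ θ : V → FOTerm F V,
      FOTerm.IsMGU θ U ∧
      (∀ x ∈ FOTerm.domain θ, ∀ t ∈ tl, ¬ FOTerm.OccursVar x t) ∧
      FOTerm.IsMGU (FOTerm.replaceSubst u c tl θ)
        (FOTerm.mapProb (FOTerm.replace u c tl) U) ∧
      (∀ x ∈ FOTerm.domain (FOTerm.replaceSubst u c tl θ), ∀ t ∈ tl,
        ¬ FOTerm.OccursVar x t) := by
  obtain ⟨θ, hθ⟩ := FOTerm.exists_isPrincipalSolution
    (A := {x | ∀ t ∈ tl, ¬ FOTerm.OccursVar x t}) hU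
    (fun p hp x hx t ht hxt =>
      hx.elim (hvars x ⟨t, ht, hxt⟩ p hp).1 (hvars x ⟨t, ht, hxt⟩ p hp).2) hunif
  exact ⟨θ, hθ.isMGU, hθ.domain_subset, hθ.isMGU_replace u c,
    (FOTerm.domain_replaceSubst_subset u c tl θ).trans hθ.domain_subset⟩
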